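/- Assume F satisfies conditions (i)–(iv), that 4 divides [F_q : F_p], and that W_F* is contained in the subfield of F_q with q^{1/4} elements. Set R := R_F, n := [F_q:F_2], and for a ∈ F_q let N(a) := |{(x,y) ∈ F_q × F_q : y^p − y = x(R(x) + a x)}|, T_{R,max} := {a : N(a) = q + (p−1)p^e·2^{n/2}}, T_{R,min} := {a : N(a) = q − (p−1)p^e·2^{n/2}}, and S_F := {t ∈ F_q : Q_q(v) = ψ_q(tv) for all v ∈ W_F*}. Then: (1) S_F = F(F_q) (the image of F on F_q) and T_{R,max} ∪ T_{R,min} = {γ_F + (F*(F(u)))² : u ∈ F_q}; (2) T_{R,max} = {γ_F + (F*(F(u)))² : u ∈ F_q with Tr_{F_q/F_2}(u·R_{F,0}(u)) = image of (n/4 + 1) in F_2}. -/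

import Mathlib

open Finset

open scoped Classical

noncomputable section

/-- Length-two Witt vectors, with the operations specialised to characteristic two. -/
def W2 (R : Type*) := R × R

namespace W2

variable {R : Type*} [CommRing R]

instance : Zero (W2 R) := ⟨((0, 0) : R × R)⟩

instance : Add (W2 R) := ⟨fun x y => ((x.1 + y.1, x.2 + y.2 + x.1 * y.1) : R × R)⟩

instance [CharP R 2] : Neg (W2 R) := ⟨fun x => ((x.1, x.2 + x.1 * x.1) : R × R)⟩

theorem fst_add (x y : W2 R) : (x + y).1 = x.1 + y.1 := rfl
theorem snd_add (x y : W2 R) : (x + y).2 = x.2 + y.2 + x.1 * y.1 := rfl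
theorem fst_zero : (0 : W2 R).1 = 0 := rfl
theorem snd_zero : (0 : W2 R).2 = 0 := rfl
theorem fst_neg [CharP R 2] (x : W2 R) : (-x).1 = x.1 := rfl
theorem snd_neg [CharP R 2] (x : W2 R) : (-x).2 = x.2 + x.1 * x.1 := rfl

instance [CharP R 2] : AddCommGroup (W2 R) where
  add := (· + ·)
  zero := 0
  neg := Neg.neg
  add_assoc a b c := Prod.ext_iff.mpr (by
    constructor <;> simp only [fst_add, snd_add] <;> ring)
  zero_add a := Prod.ext_iff.mpr (by
    constructor <;> simp [fst_add, snd_add, fst_zero, snd_zero])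
  add_zero a := Prod.ext_iff.mpr (by
    constructor <;> simp [fst_add, snd_add, fst_zero, snd_zero])
  add_comm a b := Prod.ext_iff.mpr (by
    constructor <;> simp only [fst_add, snd_add] <;> ring)
  neg_add_cancel a := Prod.ext_iff.mpr (by
    constructor
    · simp only [fst_add, fst_neg, fst_zero]
      exact CharTwo.add_self_eq_zero a.1
    · simp only [snd_add, snd_neg, snd_zero, fst_neg]
      rw [show a.2 + a.1 * a.1 + a.2 + a.1 * a.1
            = (a.2 + a.2) + (a.1 * a.1 + a.1 * a.1) by ring]
      rw [CharTwo.add_self_eq_zero, CharTwo.add_self_eq_zero, add_zero])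
  nsmul := nsmulRec
  zsmul := zsmulRec

/-- Frobenius on length-two Witt vectors (characteristic two). -/
def frob (x : W2 R) : W2 R := ((x.1 ^ 2, x.2 ^ 2) : R × R)

/-- The Witt-vector trace `Tr_{q/2} = ∑_{i=0}^{n-1} Frobⁱ`. -/
def tr [CharP R 2] (n : ℕ) (x : W2 R) : W2 R := ∑ i ∈ Finset.range n, frob^[i] x

/-- The additive character of `W₂(𝔽₂)` determined by `ξ₂(1,0) = I`
(for `I` a fixed primitive fourth root of unity), evaluated on Witt vectors
whose components lie in the prime field `𝔽₂ = {0,1}`. -/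
def xi (I : ℂ) (x : W2 R) : ℂ := (if x.1 = 0 then 1 else I) * (if x.2 = 0 then 1 else -1)

end W2

variable {K : Type*}

/-- The absolute trace `Tr_{q/2} : 𝔽_q → 𝔽₂`, computed inside `K` (here `q = 2^n`). -/
def tr2 [Field K] (n : ℕ) (x : K) : K := ∑ i ∈ Finset.range n, x ^ 2 ^ i

/-- The relative trace `Tr_{q/p} : 𝔽_q → 𝔽_p ⊆ 𝔽_q`, computed inside `K`
(here `q = p^m`). -/
def trp [Field K] (p m : ℕ) (x : K) : K := ∑ i ∈ Finset.range m, x ^ p ^ i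

/-- The character `ψ_q(x) = (-1)^{Tr_{q/2}(x)}`. -/
def psiq [Field K] (n : ℕ) (x : K) : ℂ := if tr2 n x = 0 then 1 else -1

/-- The map `Q_q(x) = ξ₂(Tr_{q/2}(x,0))` on Witt vectors of length two. -/
def Qq [Field K] [CharP K 2] (I : ℂ) (n : ℕ) (x : K) : ℂ :=
  W2.xi I (W2.tr n (((x, 0) : K × K) : W2 K))

/-- The unique `2^j`-th root in a perfect field of characteristic two. -/
def rt (L : Type*) [Field L] [ExpChar L 2] [PerfectRing L 2] (j : ℕ) (x : L) : L :=
  (fun y => (frobeniusEquiv L 2).symm y)^[j] x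

/-- Evaluation of the `𝔽_p`-linearised polynomial `∑_{i=0}^{e} c_i x^{p^i}`. -/
def Lpoly [Field K] (p e : ℕ) (c : ℕ → K) (x : K) : K :=
  ∑ i ∈ Finset.range (e + 1), c i * x ^ p ^ i

/-- The adjoint `f^*(x) = ∑_{i=0}^{e} (c_i x)^{p^{-i}}` (with `p = 2^k`). -/
def adj [Field K] [ExpChar K 2] [PerfectRing K 2] (k e : ℕ) (c : ℕ → K) (x : K) : K :=
  ∑ i ∈ Finset.range (e + 1), rt K (k * i) (c i * x)

/-- Evaluation of the `𝔽_p`-linearised polynomial `∑_{i=1}^{e} c_i x^{p^i}`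
(no constant-in-`x` coefficient). -/
def LpolyIcc [Field K] (p e : ℕ) (c : ℕ → K) (x : K) : K :=
  ∑ i ∈ Finset.Icc 1 e, c i * x ^ p ^ i

/-- The adjoint `R^*(x) = ∑_{i=1}^{e} (c_i x)^{p^{-i}}` (with `p = 2^k`). -/
def adjIcc [Field K] [ExpChar K 2] [PerfectRing K 2] (k e : ℕ) (c : ℕ → K) (x : K) : K :=
  ∑ i ∈ Finset.Icc 1 e, rt K (k * i) (c i * x)

/-- The coefficients `a_i = ∑_{j=0}^{e-i} (b_j b_{j+i})^{p^{-j}}` of `R_F` (with `p = 2^k`). -/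
def aRF [Field K] [ExpChar K 2] [PerfectRing K 2] (k e : ℕ) (b : ℕ → K) (i : ℕ) : K :=
  ∑ j ∈ Finset.range (e - i + 1), rt K (k * j) (b j * b (j + i))

/-- The linearised polynomial `R_F(x) = ∑_{i=1}^{e} a_i x^{p^i}` (with `p = 2^k`). -/
def RF [Field K] [ExpChar K 2] [PerfectRing K 2] (k e : ℕ) (b : ℕ → K) (x : K) : K :=
  ∑ i ∈ Finset.Icc 1 e, aRF k e b i * x ^ (2 ^ k) ^ i

/-- `γ_F = ∑_{0 ≤ i < j ≤ e} b_i^{p^{-i}} b_j^{p^{-j}}` (with `p = 2^k`). -/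
def gammaF [Field K] [ExpChar K 2] [PerfectRing K 2] (k e : ℕ) (b : ℕ → K) : K :=
  ∑ i ∈ Finset.range (e + 1), ∑ j ∈ Finset.Ioo i (e + 1), rt K (k * i) (b i) * rt K (k * j) (b j)

/-- `α_F(t) = γ_F + F^*(t)²`. -/
def alphaF [Field K] [ExpChar K 2] [PerfectRing K 2] (k e : ℕ) (b : ℕ → K) (t : K) : K :=
  gammaF k e b + adj k e b t ^ 2

/-- `R_{F,t}(x) = R_F(x) + α_F(t) x`. -/
def RFt [Field K] [ExpChar K 2] [PerfectRing K 2] (k e : ℕ) (b : ℕ → K) (t x : K) : K :=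
  RF k e b x + alphaF k e b t * x

/-- The number of affine points of the van der Geer–van der Vlugt curve
`y^p - y = x R(x)` with coordinates in `K`. -/
def Ncount (K : Type*) [Field K] (p : ℕ) (R : K → K) : ℕ :=
  Nat.card {z : K × K // z.2 ^ p - z.2 = z.1 * R z.1}

/-- The adjoint `F^*` of `F(x) = ∑_{i=0}^{e} b_i x^{p^i}`, with coefficients `b_i ∈ K`,
viewed as a function on the algebraic closure `𝔽` of `K`. -/
def adjBar [Field K] [CharP K 2] (k e : ℕ) (b : ℕ → K) (x : AlgebraicClosure K) : AlgebraicClosure K :=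
  adj k e (fun i => algebraMap K (AlgebraicClosure K) (b i)) x

/-- `F(x) = ∑_{i=0}^{e} b_i x^{p^i}`, with coefficients `b_i ∈ K`, viewed as a function on
the algebraic closure `𝔽` of `K` (with `p = 2^k`). -/
def LpolyBar [Field K] [CharP K 2] (k e : ℕ) (b : ℕ → K) (x : AlgebraicClosure K) : AlgebraicClosure K :=
  Lpoly (2 ^ k) e (fun i => algebraMap K (AlgebraicClosure K) (b i)) x


/-- The set `S_F = {t ∈ 𝔽_q ∣ Q_q(v) = ψ_q(tv) for all v ∈ W_F^*}`. -/
def SF (K : Type*) [Field K] [Fintype K] [CharP K 2] (I : ℂ) (k m e : ℕ) (b : ℕ → K) :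
    Set K :=
  {t : K | ∀ v : K, adjBar k e b (algebraMap K (AlgebraicClosure K) v) = 0 →
    Qq I (k * m) v = psiq (k * m) (t * v)}

/-- The set `S_{F,-} = {t ∈ S_F ∣ Q_q(t) = -(√-1)^{n/2}}`. -/
def SFminus (K : Type*) [Field K] [Fintype K] [CharP K 2] (I : ℂ) (k m e : ℕ) (b : ℕ → K) :
    Set K :=
  {t ∈ SF K I k m e b | Qq I (k * m) t = -I ^ ((k * m) / 2)}

/-- The set `S_{F,+} = {t ∈ S_F ∣ Q_q(t) = (√-1)^{n/2}}`. -/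
def SFplus (K : Type*) [Field K] [Fintype K] [CharP K 2] (I : ℂ) (k m e : ℕ) (b : ℕ → K) :
    Set K :=
  {t ∈ SF K I k m e b | Qq I (k * m) t = I ^ ((k * m) / 2)}

/-- The set `S_0 = 𝔽_q ∖ S_F`. -/
def S0 (K : Type*) [Field K] [Fintype K] [CharP K 2] (I : ℂ) (k m e : ℕ) (b : ℕ → K) :
    Set K :=
  (SF K I k m e b)ᶜ

/-- `T_{R,0}`: the set of `a` with `|C_a(𝔽_q)| = q`, for `R = R_F`. -/
def TR0 (K : Type*) [Field K] [Fintype K] [CharP K 2] (k m e : ℕ) (b : ℕ → K) : Set K :=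
  {a : K | (Ncount K (2 ^ k) (fun x => RF k e b x + a * x) : ℤ) = 2 ^ (k * m)}

/-- `T_{R,max}`: the set of `a` with `|C_a(𝔽_q)| = q + (p-1)pᵉ√q`, for `R = R_F`. -/
def TRmax (K : Type*) [Field K] [Fintype K] [CharP K 2] (k m e : ℕ) (b : ℕ → K) : Set K :=
  {a : K | (Ncount K (2 ^ k) (fun x => RF k e b x + a * x) : ℤ)
      = 2 ^ (k * m) + (2 ^ k - 1) * (2 ^ k) ^ e * 2 ^ ((k * m) / 2)}

/-- `T_{R,min}`: the set of `a` with `|C_a(𝔽_q)| = q - (p-1)pᵉ√q`, for `R = R_F`. -/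
def TRmin (K : Type*) [Field K] [Fintype K] [CharP K 2] (k m e : ℕ) (b : ℕ → K) : Set K :=
  {a : K | (Ncount K (2 ^ k) (fun x => RF k e b x + a * x) : ℤ)
      = 2 ^ (k * m) - (2 ^ k - 1) * (2 ^ k) ^ e * 2 ^ ((k * m) / 2)}

section helpers

set_option linter.unusedSectionVars false

variable {K : Type*} [Field K] [CharP K 2]

theorem c2pow_add (j : ℕ) (x y : K) : (x + y) ^ 2 ^ j = x ^ 2 ^ j + y ^ 2 ^ j :=
  add_pow_char_pow x y 2 j

theorem tr2_add (n : ℕ) (x y : K) : tr2 n (x + y) = tr2 n x + tr2 n y := by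
  simp only [tr2, c2pow_add, Finset.sum_add_distrib]

theorem tr2_zero (n : ℕ) : tr2 n (0 : K) = 0 := by
  simp [tr2]

theorem tr2_sum {ι : Type*} (n : ℕ) (s : Finset ι) (f : ι → K) :
    tr2 n (∑ i ∈ s, f i) = ∑ i ∈ s, tr2 n (f i) := by
  induction s using Finset.induction_on with
  | empty => simp [tr2_zero]
  | insert a s ha ih => rw [Finset.sum_insert ha, Finset.sum_insert ha, tr2_add, ih]

theorem tr2_pow_sq (n : ℕ) (x : K) : tr2 n x ^ 2 = tr2 n (x ^ 2) := by
  unfold tr2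
  have := sum_pow_char 2 (Finset.range n) (fun i => x ^ 2 ^ i)
  rw [this]
  refine Finset.sum_congr rfl fun i _ => ?_
  rw [← pow_mul, ← pow_mul, mul_comm]

theorem tr2_sq (n : ℕ) (x : K) (hx : x ^ 2 ^ n = x) : tr2 n (x ^ 2) = tr2 n x := by
  have h1 : tr2 n (x ^ 2) + x = tr2 n x + x ^ 2 ^ n := by
    have e1 := Finset.sum_range_succ (fun i => x ^ 2 ^ i) n
    have e2 := Finset.sum_range_succ' (fun i => x ^ 2 ^ i) n
    unfold tr2
    rw [← e1, e2]
    simp only [pow_zero, pow_one]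
    congr 1
    refine Finset.sum_congr rfl fun i _ => ?_
    rw [← pow_mul, pow_succ, mul_comm]
  rw [hx] at h1
  exact add_right_cancel h1

theorem tr2_01' (n : ℕ) (x : K) (hx : x ^ 2 ^ n = x) : tr2 n x = 0 ∨ tr2 n x = 1 := by
  have h : tr2 n x ^ 2 = tr2 n x := by rw [tr2_pow_sq, tr2_sq n x hx]
  have : tr2 n x * (tr2 n x - 1) = 0 := by linear_combination h
  rcases mul_eq_zero.mp this with h | h
  · exact Or.inl h
  · exact Or.inr (by linear_combination h)

theorem tr2_split (a c : ℕ) (x : K) : tr2 (a + c) x = tr2 a x + tr2 c (x ^ 2 ^ a) := by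
  unfold tr2
  rw [Finset.sum_range_add]
  congr 1
  refine Finset.sum_congr rfl fun i _ => ?_
  rw [← pow_mul, ← pow_add]

namespace W2

/-- Build a length-two Witt vector from its components. -/
def mk (a c : K) : W2 K := ((a, c) : K × K)

theorem mk_fst (a c : K) : (mk a c).1 = a := rfl
theorem mk_snd (a c : K) : (mk a c).2 = c := rfl

theorem ext' {x y : W2 K} (h1 : x.1 = y.1) (h2 : x.2 = y.2) : x = y := Prod.ext h1 h2

theorem frob_add (x y : W2 K) : frob (x + y) = frob x + frob y := by
  apply ext'
  · show (x.1 + y.1) ^ 2 = x.1 ^ 2 + y.1 ^ 2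
    simpa using c2pow_add 1 x.1 y.1
  · show (x.2 + y.2 + x.1 * y.1) ^ 2 = x.2 ^ 2 + y.2 ^ 2 + x.1 ^ 2 * y.1 ^ 2
    have h1 := c2pow_add 1 (x.2 + y.2) (x.1 * y.1)
    have h2 := c2pow_add 1 x.2 y.2
    simp only [pow_one] at h1 h2
    rw [h1, h2, mul_pow]

theorem frob_zero : frob (0 : W2 K) = 0 := by
  apply ext'
  · show (0 : K) ^ 2 = 0
    simp
  · show (0 : K) ^ 2 = 0
    simp

theorem frob_iter (i : ℕ) (x : W2 K) : frob^[i] x = mk (x.1 ^ 2 ^ i) (x.2 ^ 2 ^ i) := by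
  induction i with
  | zero =>
    apply ext'
    · show x.1 = x.1 ^ 2 ^ 0
      simp
    · show x.2 = x.2 ^ 2 ^ 0
      simp
  | succ i ih =>
    rw [Function.iterate_succ_apply', ih]
    show mk ((x.1 ^ 2 ^ i) ^ 2) ((x.2 ^ 2 ^ i) ^ 2) = mk (x.1 ^ 2 ^ (i+1)) (x.2 ^ 2 ^ (i+1))
    rw [← pow_mul, ← pow_mul, pow_succ]

theorem frob_iter_add (i : ℕ) (x y : W2 K) : frob^[i] (x + y) = frob^[i] x + frob^[i] y := by
  induction i with
  | zero => rfl
  | succ i ih => simp only [Function.iterate_succ_apply', ih, frob_add]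

theorem tr_add (n : ℕ) (x y : W2 K) : tr n (x + y) = tr n x + tr n y := by
  simp only [tr, frob_iter_add, Finset.sum_add_distrib]

theorem tr_zero (n : ℕ) : tr n (0 : W2 K) = 0 := by
  have := tr_add n (0 : W2 K) 0
  rw [add_zero] at this
  simpa using this

theorem tr_split (a c : ℕ) (x : W2 K) : tr (a + c) x = tr a x + tr c (frob^[a] x) := by
  unfold tr
  rw [Finset.sum_range_add]
  congr 1
  refine Finset.sum_congr rfl fun i _ => ?_
  rw [← Function.iterate_add_apply, add_comm]

theorem frob_tr (n : ℕ) (x : W2 K) : frob (tr n x) = tr n (frob x) := by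
  unfold tr
  have : ∀ s : Finset ℕ, frob (∑ i ∈ s, frob^[i] x) = ∑ i ∈ s, frob^[i] (frob x) := by
    intro s
    induction s using Finset.induction_on with
    | empty => simp [frob_zero]
    | insert a s ha ih =>
      rw [Finset.sum_insert ha, Finset.sum_insert ha, frob_add, ih,
        ← Function.iterate_succ_apply' frob, Function.iterate_succ_apply]
  exact this _

theorem tr_frob (n : ℕ) (x : W2 K) (hx : frob^[n] x = x) : tr n (frob x) = tr n x := by
  have h1 : tr (n + 1) x = tr n x + x := by
    unfold tr
    rw [Finset.sum_range_succ, hx]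
  have h2 : tr (n + 1) x = tr n (frob x) + x := by
    unfold tr
    rw [Finset.sum_range_succ']
    rfl
  exact add_right_cancel (h2.symm.trans h1)

theorem tr_01 (n : ℕ) (x : W2 K) (hx : frob^[n] x = x) :
    ((tr n x).1 = 0 ∨ (tr n x).1 = 1) ∧ ((tr n x).2 = 0 ∨ (tr n x).2 = 1) := by
  have h : frob (tr n x) = tr n x := by rw [frob_tr, tr_frob n x hx]
  have h1 : (tr n x).1 ^ 2 = (tr n x).1 := congrArg Prod.fst h
  have h2 : (tr n x).2 ^ 2 = (tr n x).2 := congrArg Prod.snd h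
  have aux : ∀ z : K, z ^ 2 = z → z = 0 ∨ z = 1 := by
    intro z hz
    have : z * (z - 1) = 0 := by linear_combination hz
    rcases mul_eq_zero.mp this with h | h
    · exact Or.inl h
    · exact Or.inr (by linear_combination h)
  exact ⟨aux _ h1, aux _ h2⟩

theorem tr_zero_fst (n : ℕ) (z : K) : tr n (mk 0 z) = mk 0 (tr2 n z) := by
  induction n with
  | zero => simp only [tr, tr2, Finset.range_zero, Finset.sum_empty]; rfl
  | succ n ih =>
    have : tr (n + 1) (mk 0 z) = tr n (mk 0 z) + frob^[n] (mk 0 z) := by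
      unfold tr; rw [Finset.sum_range_succ]
    rw [this, ih, frob_iter]
    apply ext'
    · show (0 : K) + 0 ^ 2 ^ n = 0
      simp
    · show tr2 n z + z ^ 2 ^ n + 0 * 0 ^ 2 ^ n = tr2 (n + 1) z
      simp [tr2, Finset.sum_range_succ]

theorem xi_add (I : ℂ) (hI : I ^ 2 = -1) (x y : W2 K)
    (hx : (x.1 = 0 ∨ x.1 = 1) ∧ (x.2 = 0 ∨ x.2 = 1))
    (hy : (y.1 = 0 ∨ y.1 = 1) ∧ (y.2 = 0 ∨ y.2 = 1)) : xi I (x + y) = xi I x * xi I y := by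
  have h2 : (1 : K) + 1 = 0 := CharTwo.add_self_eq_zero 1
  have hI' : I * I = -1 := by rw [← hI]; ring
  unfold xi
  rw [fst_add, snd_add]
  obtain ⟨h1 | h1, h3 | h3⟩ := hx <;> obtain ⟨h4 | h4, h5 | h5⟩ := hy <;>
    rw [h1, h3, h4, h5] <;> simp [h2, hI']

end W2


section fin

variable [Fintype K] {n : ℕ}

theorem kpow (hcard : Fintype.card K = 2 ^ n) (x : K) : x ^ 2 ^ n = x := by
  rw [← hcard]; exact FiniteField.pow_card x

theorem tr2_01 (hcard : Fintype.card K = 2 ^ n) (x : K) : tr2 n x = 0 ∨ tr2 n x = 1 :=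
  tr2_01' n x (kpow hcard x)

theorem tr2_pow (hcard : Fintype.card K = 2 ^ n) (x : K) (j : ℕ) :
    tr2 n (x ^ 2 ^ j) = tr2 n x := by
  induction j with
  | zero => simp
  | succ j ih => rw [pow_succ, pow_mul, tr2_sq _ _ (kpow hcard _), ih]

theorem tr2_ne (hcard : Fintype.card K = 2 ^ n) : ∃ x : K, tr2 n x ≠ 0 := by
  let _ : Algebra (ZMod 2) K := ZMod.algebra K 2
  obtain ⟨x, hx⟩ := Algebra.trace_surjective (ZMod 2) K 1
  refine ⟨x, ?_⟩
  have h := FiniteField.algebraMap_trace_eq_sum_pow (ZMod 2) K x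
  have hn : Module.finrank (ZMod 2) K = n := by
    have := Module.card_eq_pow_finrank (K := ZMod 2) (V := K)
    rw [hcard, ZMod.card] at this
    exact (Nat.pow_right_injective (le_refl 2) this).symm
  rw [hx, hn, Nat.card_zmod, map_one] at h
  rw [tr2, ← h]
  exact one_ne_zero

theorem psi_add (hcard : Fintype.card K = 2 ^ n) (x y : K) :
    psiq n (x + y) = psiq n x * psiq n y := by
  have h2 : (1 : K) + 1 = 0 := CharTwo.add_self_eq_zero 1
  unfold psiq
  rw [tr2_add]
  rcases tr2_01 hcard x with h | h <;> rcases tr2_01 hcard y with h' | h' <;>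
    rw [h, h'] <;> simp [h2]

theorem psi_zero : psiq n (0 : K) = 1 := by simp [psiq, tr2_zero]

theorem psi_pm (x : K) : psiq n x = 1 ∨ psiq n x = -1 := by
  unfold psiq; split_ifs <;> simp

theorem psi_mul_self (x : K) : psiq n x * psiq n x = 1 := by
  rcases psi_pm (n := n) x with h | h <;> rw [h] <;> norm_num

theorem psi_congr {x y : K} (h : tr2 n x = tr2 n y) : psiq n x = psiq n y := by
  unfold psiq; rw [h]

theorem psi_pow (hcard : Fintype.card K = 2 ^ n) (x : K) (j : ℕ) :
    psiq n (x ^ 2 ^ j) = psiq n x := psi_congr (tr2_pow hcard x j)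

theorem psi_nondeg (hcard : Fintype.card K = 2 ^ n) (y : K) (hy : y ≠ 0) :
    ∃ x : K, psiq n (x * y) = -1 := by
  obtain ⟨x, hx⟩ := tr2_ne hcard
  refine ⟨x / y, ?_⟩
  rw [div_mul_cancel₀ _ hy]
  simp [psiq, hx]

/-- The additive character of `W₂(K)`. -/
def chi (I : ℂ) (n : ℕ) (x : W2 K) : ℂ := W2.xi I (W2.tr n x)

theorem frob_n (hcard : Fintype.card K = 2 ^ n) (x : W2 K) : W2.frob^[n] x = x := by
  rw [W2.frob_iter, kpow hcard, kpow hcard]; rfl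

theorem chi_add (hcard : Fintype.card K = 2 ^ n) {I : ℂ} (hI : I ^ 2 = -1) (x y : W2 K) :
    chi I n (x + y) = chi I n x * chi I n y := by
  unfold chi
  rw [W2.tr_add]
  exact W2.xi_add I hI _ _ (W2.tr_01 n x (frob_n hcard x)) (W2.tr_01 n y (frob_n hcard y))

theorem chi_zero_fst (I : ℂ) (z : K) : chi I n (W2.mk 0 z) = psiq n z := by
  unfold chi
  rw [W2.tr_zero_fst]
  unfold W2.xi psiq
  rw [W2.mk_fst, W2.mk_snd]
  by_cases h : tr2 n z = 0 <;> simp [h]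

theorem Q_chi (I : ℂ) (x : K) : Qq I n x = chi I n (W2.mk x 0) := rfl

theorem Q_add (hcard : Fintype.card K = 2 ^ n) {I : ℂ} (hI : I ^ 2 = -1) (x y : K) :
    Qq I n (x + y) * psiq n (x * y) = Qq I n x * Qq I n y := by
  simp only [Q_chi]
  rw [← chi_zero_fst I, ← chi_add hcard hI, ← chi_add hcard hI]
  congr 1
  apply W2.ext'
  · simp [W2.fst_add, W2.mk_fst]
  · simp [W2.snd_add, W2.mk_fst, W2.mk_snd]

theorem Q_add' (hcard : Fintype.card K = 2 ^ n) {I : ℂ} (hI : I ^ 2 = -1) (x y : K) :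
    Qq I n (x + y) = Qq I n x * Qq I n y * psiq n (x * y) := by
  rw [← Q_add hcard hI, mul_assoc, psi_mul_self, mul_one]

theorem Q_zero (I : ℂ) : Qq I n (0 : K) = 1 := by
  rw [Q_chi, chi_zero_fst, psi_zero]

theorem Q_ne (hcard : Fintype.card K = 2 ^ n) {I : ℂ} (hI : I ^ 2 = -1) (x : K) :
    Qq I n x ≠ 0 := by
  intro h
  have := Q_add hcard hI x x
  rw [h, CharTwo.add_self_eq_zero, Q_zero] at this
  rcases psi_pm (n := n) (x * x) with h | h <;> rw [h] at this <;> norm_num at this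

theorem Q_pow (hcard : Fintype.card K = 2 ^ n) (I : ℂ) (x : K) (j : ℕ) :
    Qq I n (x ^ 2 ^ j) = Qq I n x := by
  induction j with
  | zero => simp
  | succ j ih =>
    rw [← ih]
    have : W2.mk (x ^ 2 ^ (j+1)) 0 = W2.frob (W2.mk (x ^ 2 ^ j) 0) := by
      apply W2.ext'
      · show x ^ 2 ^ (j+1) = (x ^ 2 ^ j) ^ 2
        rw [← pow_mul, pow_succ]
      · show (0 : K) = 0 ^ 2
        simp
    rw [Q_chi, Q_chi, this, chi, W2.tr_frob _ _ (frob_n hcard _), chi]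

theorem Q_sum (hcard : Fintype.card K = 2 ^ n) {I : ℂ} (hI : I ^ 2 = -1) (f : ℕ → K) (N : ℕ) :
    Qq I n (∑ i ∈ Finset.range N, f i) *
      psiq n (∑ i ∈ Finset.range N, ∑ j ∈ Finset.Ioo i N, f i * f j)
      = ∏ i ∈ Finset.range N, Qq I n (f i) := by
  induction N with
  | zero => simp [Q_zero, psi_zero]
  | succ N ih =>
    have key : ∑ i ∈ Finset.range (N + 1), ∑ j ∈ Finset.Ioo i (N + 1), f i * f j
        = (∑ i ∈ Finset.range N, ∑ j ∈ Finset.Ioo i N, f i * f j)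
          + (∑ i ∈ Finset.range N, f i) * f N := by
      rw [Finset.sum_range_succ]
      have h0 : Finset.Ioo N (N + 1) = ∅ := by
        apply Finset.eq_empty_of_forall_notMem
        intro j hj
        rw [Finset.mem_Ioo] at hj
        omega
      rw [h0, Finset.sum_empty, add_zero, Finset.sum_mul, ← Finset.sum_add_distrib]
      refine Finset.sum_congr rfl fun i hi => ?_
      rw [Finset.mem_range] at hi
      have h1 : Finset.Ioo i (N + 1) = insert N (Finset.Ioo i N) := by
        ext j; simp only [Finset.mem_Ioo, Finset.mem_insert]; omega
      rw [h1, Finset.sum_insert (by simp), add_comm]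
    rw [key, Finset.sum_range_succ, Finset.prod_range_succ, ← ih, psi_add hcard,
      Q_add' hcard hI]
    linear_combination (Qq I n (∑ i ∈ Finset.range N, f i) * Qq I n (f N) *
      psiq n (∑ i ∈ Finset.range N, ∑ j ∈ Finset.Ioo i N, f i * f j)) *
      psi_mul_self (n := n) ((∑ i ∈ Finset.range N, f i) * f N)

/-- Orthogonal complement with respect to the pairing `ψ(xy)`. -/
def perp (n : ℕ) (hcard : Fintype.card K = 2 ^ n) (H : AddSubgroup K) : AddSubgroup K where
  carrier := {y | ∀ l ∈ H, psiq n (l * y) = 1}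
  zero_mem' := by intro l _; rw [mul_zero, psi_zero]
  add_mem' := by
    intro a c ha hc l hl
    rw [mul_add, psi_add hcard, ha l hl, hc l hl, one_mul]
  neg_mem' := by
    intro a ha l hl
    rw [CharTwo.neg_eq]; exact ha l hl

theorem mem_perp (hcard : Fintype.card K = 2 ^ n) {H : AddSubgroup K} {y : K} :
    y ∈ perp n hcard H ↔ ∀ l ∈ H, psiq n (l * y) = 1 := Iff.rfl

theorem sum_psi (hcard : Fintype.card K = 2 ^ n) (H : AddSubgroup K) [Fintype H] (y : K) :
    ∑ l : H, psiq n ((l : K) * y) = if y ∈ perp n hcard H then (Nat.card H : ℂ) else 0 := by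
  split_ifs with h
  · rw [Finset.sum_congr rfl fun l _ => h l.1 l.2]
    simp
  · rw [mem_perp] at h
    push Not at h
    obtain ⟨l, hl, hne⟩ := h
    have h1 : psiq n (l * y) = -1 := (psi_pm _).resolve_left hne
    have h2 := Equiv.sum_comp (Equiv.addRight (⟨l, hl⟩ : H)) (fun z : H => psiq n ((z : K) * y))
    simp only [Equiv.coe_addRight, AddSubgroup.coe_add, add_mul, psi_add hcard, h1] at h2
    rw [← Finset.sum_mul] at h2
    linear_combination (-1/2 : ℂ) * h2

theorem card_perp (hcard : Fintype.card K = 2 ^ n) (H : AddSubgroup K) :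
    Nat.card H * Nat.card (perp n hcard H) = Nat.card K := by
  have h1 : ∑ y : K, ∑ l : H, psiq n ((l : K) * y)
      = (Nat.card H : ℂ) * Nat.card (perp n hcard H) := by
    rw [Finset.sum_congr rfl fun y _ => sum_psi hcard H y, ← Finset.sum_filter,
      Finset.sum_const, nsmul_eq_mul, mul_comm]
    congr 2
    rw [Nat.card_eq_fintype_card, Fintype.card_subtype]
  have h2 : ∑ y : K, ∑ l : H, psiq n ((l : K) * y) = (Nat.card K : ℂ) := by
    rw [Finset.sum_comm, Finset.sum_eq_single (0 : H)]
    · simp [psi_zero]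
    · intro l _ hl
      have hl' : (l : K) ≠ 0 := by simpa using hl
      obtain ⟨x, hx⟩ := psi_nondeg hcard (l : K) hl'
      have h2 := Equiv.sum_comp (Equiv.addRight x) (fun z : K => psiq n ((l : K) * z))
      rw [mul_comm] at hx
      simp only [Equiv.coe_addRight, mul_add, psi_add hcard, hx] at h2
      rw [← Finset.sum_mul] at h2
      linear_combination (-1/2 : ℂ) * h2
    · simp
  rw [h1] at h2
  exact_mod_cast h2

theorem perp_perp (hcard : Fintype.card K = 2 ^ n) (H : AddSubgroup K) :
    perp n hcard (perp n hcard H) = H := by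
  symm
  have hle : H ≤ perp n hcard (perp n hcard H) := by
    intro x hx y hy
    rw [mul_comm]; exact hy x hx
  apply AddSubgroup.eq_of_le_of_card_ge hle
  have h1 := card_perp hcard H
  have h2 := card_perp hcard (perp n hcard H)
  have hp : 0 < Nat.card (perp n hcard H) := Nat.card_pos
  apply le_of_eq
  apply Nat.eq_of_mul_eq_mul_left hp
  rw [h2, ← h1, mul_comm]

theorem perp_range (hcard : Fintype.card K = 2 ^ n) (F A : K →+ K)
    (hFA : ∀ t x, psiq n (t * F x) = psiq n (A t * x)) :
    F.range = perp n hcard A.ker := by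
  rw [← perp_perp hcard F.range]
  congr 1
  ext t
  rw [mem_perp, AddMonoidHom.mem_ker]
  constructor
  · intro h
    by_contra hne
    obtain ⟨x, hx⟩ := psi_nondeg hcard _ hne
    have := h (F x) ⟨x, rfl⟩
    rw [mul_comm, hFA, mul_comm, hx] at this
    norm_num at this
  · rintro h _ ⟨x, rfl⟩
    rw [mul_comm, hFA, h, zero_mul, psi_zero]

section mainsum

variable (hcard : Fintype.card K = 2 ^ n) {I : ℂ} (hI : I ^ 2 = -1) (F A : K →+ K)
    (hFA : ∀ t x, psiq n (t * F x) = psiq n (A t * x))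
    (hQ : ∀ w, A w = 0 → Qq I n w = 1)
    (hW : ∀ w w', A w = 0 → A w' = 0 → psiq n (w * w') = 1)

include hcard hI hFA hQ in
theorem sum_zero (s : K) (hs : ∀ u, A (F u) ≠ s) :
    ∑ x : K, Qq I n (F x) * psiq n (s * x) = 0 := by
  have hE : ∀ t x, psiq n (t * (A.comp F) x) = psiq n ((A.comp F) t * x) := by
    intro t x
    simp only [AddMonoidHom.comp_apply]
    rw [mul_comm, ← hFA, mul_comm, hFA]
  have h1 : s ∉ (A.comp F).range := by
    rintro ⟨u, hu⟩
    exact hs u hu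
  rw [perp_range hcard _ _ hE, mem_perp] at h1
  push Not at h1
  obtain ⟨z, hz, hne⟩ := h1
  have hz' : A (F z) = 0 := hz
  have hm : psiq n (s * z) = -1 := by
    rw [mul_comm]; exact (psi_pm _).resolve_left hne
  have h2 := Equiv.sum_comp (Equiv.addRight z) (fun x : K => Qq I n (F x) * psiq n (s * x))
  have h3 : ∀ x, Qq I n (F (x + z)) * psiq n (s * (x + z))
      = - (Qq I n (F x) * psiq n (s * x)) := by
    intro x
    rw [map_add, Q_add' hcard hI, hQ _ hz', mul_add, psi_add hcard, hm, mul_comm (F x), hFA, hz',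
      zero_mul, psi_zero]
    ring
  simp only [Equiv.coe_addRight, h3, Finset.sum_neg_distrib] at h2
  linear_combination (-1/2 : ℂ) * h2

include hcard hI hFA in
theorem sum_shift (u : K) :
    Qq I n (F u) * ∑ x : K, Qq I n (F x) * psiq n (A (F u) * x) = ∑ x : K, Qq I n (F x) := by
  have h2 := Equiv.sum_comp (Equiv.addRight u) (fun x : K => Qq I n (F x))
  rw [← h2, Finset.mul_sum]
  refine Finset.sum_congr rfl fun x _ => ?_
  rw [Equiv.coe_addRight, map_add, Q_add' hcard hI, ← hFA, mul_comm (F u)]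
  ring

include hcard hI hFA hQ hW in
theorem sum_G0 : ∑ x : K, Qq I n (F x) = Nat.card A.ker * ∑ y : K, Qq I n y := by
  have hr := perp_range hcard F A hFA
  have h1 : ∑ y : K, ∑ x : K, Qq I n (y + F x) = (Nat.card K : ℂ) * ∑ y : K, Qq I n y := by
    rw [Finset.sum_comm]
    have : ∀ x, ∑ y : K, Qq I n (y + F x) = ∑ y : K, Qq I n y := fun x =>
      Equiv.sum_comp (Equiv.addRight (F x)) (fun y : K => Qq I n y)
    rw [Finset.sum_congr rfl fun x _ => this x]
    simp
  have h2 : ∀ y : K, ∑ x : K, Qq I n (y + F x)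
      = if y ∈ F.range then ∑ x : K, Qq I n (F x) else 0 := by
    intro y
    have e : ∑ x : K, Qq I n (y + F x)
        = Qq I n y * ∑ x : K, Qq I n (F x) * psiq n (A y * x) := by
      rw [Finset.mul_sum]
      refine Finset.sum_congr rfl fun x _ => ?_
      rw [Q_add' hcard hI, hFA]
      ring
    rw [e]
    split_ifs with h
    · obtain ⟨u, rfl⟩ := h
      exact sum_shift hcard hI F A hFA u
    · rw [sum_zero hcard hI F A hFA hQ, mul_zero]
      intro u hu
      apply h
      have hk : A (y - F u) = 0 := by rw [map_sub, hu, sub_self]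
      have hm : y - F u ∈ F.range := by
        rw [hr, mem_perp]
        intro l hl
        exact hW _ _ hl hk
      have := AddSubgroup.add_mem _ hm (⟨u, rfl⟩ : F u ∈ F.range)
      simpa using this
  rw [Finset.sum_congr rfl fun y _ => h2 y, ← Finset.sum_filter, Finset.sum_const,
    nsmul_eq_mul] at h1
  have h3 := card_perp hcard A.ker
  rw [← hr] at h3
  have h4 : (Finset.univ.filter fun y => y ∈ F.range).card = Nat.card F.range := by
    rw [Nat.card_eq_fintype_card, Fintype.card_subtype]
  rw [h4, ← h3] at h1
  have hp : (Nat.card F.range : ℂ) ≠ 0 := by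
    exact_mod_cast Nat.card_pos.ne'
  apply mul_left_cancel₀ hp
  rw [h1]
  push_cast
  ring

end mainsum

/-- The additive map `x ↦ x^{2^d} + x`. -/
def asMap (K : Type*) [Field K] [CharP K 2] (d : ℕ) : K →+ K where
  toFun x := x ^ 2 ^ d + x
  map_zero' := by simp
  map_add' x y := by rw [c2pow_add]; ring

theorem mem_ker_as {d : ℕ} {x : K} : x ∈ (asMap K d).ker ↔ x ^ 2 ^ d = x := by
  rw [AddMonoidHom.mem_ker]
  show x ^ 2 ^ d + x = 0 ↔ _
  rw [CharTwo.add_eq_zero]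

open Polynomial in
theorem card_ker_as (hcard : Fintype.card K = 2 ^ n) {d : ℕ} (hd : d ≠ 0) (hdn : d ∣ n) :
    Nat.card (asMap K d).ker = 2 ^ d := by
  have hne : (X ^ 2 ^ d - X : K[X]) ≠ 0 := FiniteField.X_pow_card_pow_sub_X_ne_zero K hd (by norm_num)
  have hsp : (X ^ 2 ^ d - X : K[X]).Splits := by
    have hdv : (X ^ 2 ^ d - X : K[X]) ∣ X ^ 2 ^ n - X := dvd_pow_pow_sub_self_of_dvd hdn
    refine Splits.of_dvd ?_ ?_ hdv
    · rw [← hcard]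
      rw [splits_iff_card_roots, FiniteField.roots_X_pow_card_sub_X,
        FiniteField.X_pow_card_sub_X_natDegree_eq K Fintype.one_lt_card]
      rfl
    · rw [← hcard]; exact FiniteField.X_pow_card_sub_X_ne_zero K Fintype.one_lt_card
  have hsep : (X ^ 2 ^ d - X : K[X]).Separable := galois_poly_separable 2 _ (dvd_pow_self 2 hd)
  have h1 := hsp.natDegree_eq_card_roots
  rw [FiniteField.X_pow_card_pow_sub_X_natDegree_eq K hd (by norm_num)] at h1
  rw [h1, ← Multiset.toFinset_card_of_nodup (nodup_roots hsep)]
  rw [Nat.card_eq_fintype_card, Fintype.card_subtype]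
  congr 1
  ext x
  rw [Finset.mem_filter, Multiset.mem_toFinset, mem_roots hne, mem_ker_as]
  simp [IsRoot, sub_eq_zero]

theorem range_as (hcard : Fintype.card K = 2 ^ n) {d : ℕ} (hdn : d ≤ n) :
    (asMap K d).range = perp n hcard (asMap K d).ker := by
  rw [perp_range hcard (asMap K d) (asMap K (n - d))]
  · congr 1
    ext t
    rw [mem_ker_as, mem_ker_as]
    constructor
    · intro h
      have := kpow hcard t
      rw [← Nat.sub_add_cancel hdn, pow_add, pow_mul, h] at this
      exact this
    · intro h
      have := kpow hcard t
      rw [← Nat.add_sub_cancel' hdn, pow_add, pow_mul, h] at this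
      exact this
  · intro t x
    show psiq n (t * (x ^ 2 ^ d + x)) = psiq n ((t ^ 2 ^ (n - d) + t) * x)
    rw [mul_add, add_mul, psi_add hcard, psi_add hcard]
    congr 1
    rw [← psi_pow hcard (t ^ 2 ^ (n - d) * x) d, mul_pow, ← pow_mul, ← pow_add,
      Nat.sub_add_cancel hdn, kpow hcard]

theorem card_fiber (hcard : Fintype.card K = 2 ^ n) {k : ℕ} (hkn : k ≤ n) (z : K) :
    (Nat.card {y : K // y ^ 2 ^ k - y = z} : ℂ) = ∑ l : (asMap K k).ker, psiq n ((l : K) * z) := by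
  rw [sum_psi hcard, ← range_as hcard hkn]
  split_ifs with h
  · obtain ⟨y0, hy0⟩ := h
    have hy0' : y0 ^ 2 ^ k + y0 = z := hy0
    congr 1
    refine Nat.card_congr ⟨fun y => ⟨y.1 + y0, ?_⟩, fun l => ⟨l.1 + y0, ?_⟩, ?_, ?_⟩
    · have := y.2
      rw [CharTwo.sub_eq_add] at this
      rw [mem_ker_as, c2pow_add]
      have h2 : y.1 ^ 2 ^ k + y.1 + (y0 ^ 2 ^ k + y0) = 0 := by
        rw [this, hy0', CharTwo.add_self_eq_zero]
      rw [← CharTwo.add_eq_zero, ← h2]; ring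
    · have := mem_ker_as.mp l.2
      rw [c2pow_add, this, ← hy0']
      rw [CharTwo.sub_eq_add]
      have h2 := CharTwo.add_self_eq_zero l.1
      linear_combination h2
    · intro y; apply Subtype.ext; simp [add_assoc, CharTwo.add_self_eq_zero]
    · intro y; apply Subtype.ext; simp [add_assoc, CharTwo.add_self_eq_zero]
  · rw [Nat.cast_eq_zero, Nat.card_eq_zero]
    left
    constructor
    rintro ⟨y, hy⟩
    apply h
    refine ⟨y, ?_⟩
    rw [← hy, CharTwo.sub_eq_add]; rfl

theorem Ncount_eq (hcard : Fintype.card K = 2 ^ n) {k : ℕ} (hk : 1 ≤ k) (hkn : k ∣ n)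
    (hn : n ≠ 0) (R : K → K)
    (hR : ∀ d x : K, d ^ 2 ^ k = d → R (d * x) = d * R x) :
    (Ncount K (2 ^ k) R : ℂ) = 2 ^ n + (2 ^ k - 1) * ∑ x : K, psiq n (x * R x) := by
  have hle : k ≤ n := Nat.le_of_dvd (Nat.pos_of_ne_zero hn) hkn
  have h1 : (Ncount K (2 ^ k) R : ℂ)
      = ∑ x : K, ∑ l : (asMap K k).ker, psiq n ((l : K) * (x * R x)) := by
    rw [Ncount]
    have e : {z : K × K // z.2 ^ 2 ^ k - z.2 = z.1 * R z.1}
        ≃ Σ x : K, {y : K // y ^ 2 ^ k - y = x * R x} :=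
      ⟨fun z => ⟨z.1.1, z.1.2, z.2⟩, fun w => ⟨(w.1, w.2.1), w.2.2⟩, fun _ => rfl, fun _ => rfl⟩
    rw [Nat.card_congr e, Nat.card_sigma, Nat.cast_sum]
    exact Finset.sum_congr rfl fun x _ => card_fiber hcard hle _
  rw [h1, Finset.sum_comm, ← Finset.add_sum_erase _ _ (Finset.mem_univ (0 : (asMap K k).ker))]
  have h2 : ∀ l ∈ Finset.univ.erase (0 : (asMap K k).ker),
      ∑ x : K, psiq n ((l : K) * (x * R x)) = ∑ x : K, psiq n (x * R x) := by
    intro l hl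
    have hl0 : (l : K) ≠ 0 := by
      have := Finset.ne_of_mem_erase hl
      simpa using this
    have hl1 := mem_ker_as.mp l.2
    set d : K := (l : K) ^ 2 ^ (k - 1) with hd
    have hd2 : d * d = l := by
      rw [← pow_two, hd, ← pow_mul, ← pow_succ, Nat.sub_add_cancel hk, hl1]
    have hdk : d ^ 2 ^ k = d := by
      rw [hd, ← pow_mul, mul_comm, pow_mul, hl1]
    have hd0 : d ≠ 0 := by
      intro h; rw [h] at hd2; exact hl0 (by rw [← hd2]; simp)
    have h3 := Equiv.sum_comp (Equiv.mulLeft₀ d hd0) (fun x : K => psiq n (x * R x))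
    rw [← h3]
    refine Finset.sum_congr rfl fun x _ => ?_
    show psiq n (_) = psiq n (d * x * R (d * x))
    rw [hR d x hdk, ← hd2]
    congr 1
    ring
  rw [Finset.sum_congr rfl h2, Finset.sum_const, Finset.card_erase_of_mem (Finset.mem_univ _),
    Finset.card_univ, ← Nat.card_eq_fintype_card, card_ker_as hcard (by omega) hkn, nsmul_eq_mul]
  have h4 : (1 : ℕ) ≤ 2 ^ k := Nat.one_le_two_pow
  simp [psi_zero, hcard, Nat.cast_sub h4]

theorem tr_four (s : ℕ) (X : W2 K) (hX : W2.frob^[s] X = X) : W2.tr (4 * s) X = 0 := by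
  have h4 : X + X + X + X = 0 := by
    have h2 : ∀ a : K, a + a = 0 := CharTwo.add_self_eq_zero
    apply W2.ext'
    · show X.1 + X.1 + X.1 + X.1 = 0
      linear_combination 2 * h2 X.1
    · show X.2 + X.2 + X.1 * X.1 + X.2 + (X.1 + X.1) * X.1 + X.2 + (X.1 + X.1 + X.1) * X.1 = 0
      linear_combination 2 * h2 X.2 + 3 * h2 (X.1 * X.1)
  have : 4 * s = s + (s + (s + s)) := by ring
  rw [this]
  simp only [W2.tr_split s, hX]
  rw [← W2.tr_add, ← W2.tr_add, ← W2.tr_add, ← W2.tr_zero s]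
  congr 1
  rw [← h4]; abel

theorem Q_sub (I : ℂ) (s : ℕ) (x : K) (hx : x ^ 2 ^ s = x) : Qq I (4 * s) x = 1 := by
  rw [Q_chi, chi, tr_four]
  · simp [W2.xi, W2.fst_zero, W2.snd_zero]
  · rw [W2.frob_iter, W2.mk_fst, W2.mk_snd, hx]; simp

theorem tr2_two (h : ℕ) (x : K) (hx : x ^ 2 ^ h = x) : tr2 (h + h) x = 0 := by
  rw [tr2_split, hx, CharTwo.add_self_eq_zero]

theorem tr2_tele (h : ℕ) (c : K) : tr2 h (c ^ 2 + c) = c ^ 2 ^ h + c := by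
  induction h with
  | zero => simp [tr2, CharTwo.add_self_eq_zero]
  | succ h ih =>
    have : tr2 (h + 1) (c ^ 2 + c) = tr2 h (c ^ 2 + c) + (c ^ 2 + c) ^ 2 ^ h := by
      simp [tr2, Finset.sum_range_succ]
    rw [this, ih, c2pow_add, ← pow_mul, ← pow_succ']
    have := CharTwo.add_self_eq_zero (c ^ 2 ^ h)
    linear_combination this

theorem tr_one (s : ℕ) : W2.tr (s + s) (W2.mk (1 : K) 0) = W2.mk 0 (s : K) := by
  have h1 : W2.frob^[s] (W2.mk (1 : K) 0) = W2.mk 1 0 := by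
    rw [W2.frob_iter]; simp [W2.mk_fst, W2.mk_snd]
  have h2 : W2.mk (1 : K) 0 + W2.mk 1 0 = W2.mk 0 1 := by
    apply W2.ext'
    · simp [W2.fst_add, W2.mk_fst, CharTwo.add_self_eq_zero]
    · simp [W2.snd_add, W2.mk_fst, W2.mk_snd]
  rw [W2.tr_split, h1, ← W2.tr_add, h2, W2.tr_zero_fst]
  simp [tr2]

theorem gauss (s : ℕ) (hs : s ≠ 0) (hcard : Fintype.card K = 2 ^ (4 * s)) {I : ℂ}
    (hI : I ^ 2 = -1) :
    ∑ y : K, Qq I (4 * s) y = (if ((s + 1 : ℕ) : K) = 0 then 1 else -1) * 2 ^ (2 * s) := by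
  set L := (asMap K (2 * s)).ker with hL
  have hLc : Nat.card L = 2 ^ (2 * s) := card_ker_as hcard (by omega) ⟨2, by ring⟩
  have h4 : 4 * s = 2 * s + 2 * s := by ring
  have hr := range_as hcard (d := 2 * s) (by omega)
  rw [← hL] at hr
  have hLL : L = perp _ hcard L := by
    apply AddSubgroup.eq_of_le_of_card_ge
    · intro x hx l hl
      have hx' := mem_ker_as.mp hx
      have hl' := mem_ker_as.mp hl
      have : tr2 (4 * s) (l * x) = 0 := by
        rw [h4]; apply tr2_two
        rw [mul_pow, hx', hl']
      simp [psiq, this]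
    · have h := card_perp hcard L
      rw [hLc, Nat.card_eq_fintype_card (α := K), hcard] at h
      rw [hLc]
      apply le_of_eq
      apply Nat.eq_of_mul_eq_mul_left (show 0 < 2 ^ (2 * s) by positivity)
      rw [h, ← pow_add, h4]
  have h1 : (1 : K) ∈ (asMap K (2 * s)).range := by
    rw [hr, ← hLL, hL, mem_ker_as, one_pow]
  obtain ⟨c, hc⟩ := h1
  have hc' : c ^ 2 ^ (2 * s) + c = 1 := hc
  have hcb : c ^ 2 ^ (2 * s) = c + 1 := by
    rw [← hc']; have := CharTwo.add_self_eq_zero c; linear_combination -this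
  -- value at c
  have hQc : Qq I (4 * s) c = if ((s + 1 : ℕ) : K) = 0 then 1 else -1 := by
    rw [Q_chi, chi]
    have e1 : W2.mk c 0 + W2.frob^[2 * s] (W2.mk c 0) = W2.mk 1 0 + W2.mk 0 (c ^ 2 + c) := by
      rw [W2.frob_iter]
      apply W2.ext'
      · simp only [W2.fst_add, W2.mk_fst, hcb]
        have := CharTwo.add_self_eq_zero c
        linear_combination this
      · simp only [W2.snd_add, W2.mk_fst, W2.mk_snd, hcb]
        simp; ring
    have e2 : W2.tr (4 * s) (W2.mk c 0) = W2.mk 0 ((s + 1 : ℕ) : K) := by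
      rw [h4, W2.tr_split, ← W2.tr_add, e1, W2.tr_add, W2.tr_zero_fst, tr2_tele, hc', two_mul,
        tr_one]
      apply W2.ext'
      · simp [W2.fst_add, W2.mk_fst]
      · simp [W2.snd_add, W2.mk_fst, W2.mk_snd]
    rw [e2]
    unfold W2.xi
    rw [W2.mk_fst, W2.mk_snd]
    by_cases h : ((s + 1 : ℕ) : K) = 0 <;> simp only [h] <;> simp
  have hQL : ∀ l ∈ L, Qq I (4 * s) l * psiq (4 * s) (c * l) = 1 := by
    intro l hl
    have hl' := mem_ker_as.mp hl
    have e1 : Qq I (4 * s) l = if tr2 (2 * s) l = 0 then 1 else -1 := by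
      rw [Q_chi, chi, h4, W2.tr_split, ← W2.tr_add]
      have : W2.mk l 0 + W2.frob^[2 * s] (W2.mk l 0) = W2.mk 0 (l ^ 2) := by
        rw [W2.frob_iter]
        apply W2.ext'
        · simp only [W2.fst_add, W2.mk_fst, hl', CharTwo.add_self_eq_zero]
        · simp only [W2.snd_add, W2.mk_fst, W2.mk_snd, hl']
          simp; ring
      rw [this, W2.tr_zero_fst, tr2_sq _ _ hl']
      unfold W2.xi
      rw [W2.mk_fst, W2.mk_snd]
      by_cases h : tr2 (2 * s) l = 0 <;> simp [h]
    have e2 : tr2 (4 * s) (c * l) = tr2 (2 * s) l := by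
      rw [h4, tr2_split, mul_pow, hl', hcb, ← tr2_add]
      congr 1
      have := CharTwo.add_self_eq_zero (c * l)
      linear_combination this
    rw [e1, psiq, e2]
    by_cases h : tr2 (2 * s) l = 0 <;> simp [h]
  -- the sum
  have hsum : (Nat.card L : ℂ) * ∑ y : K, Qq I (4 * s) y * psiq (4 * s) (c * y)
      = (Nat.card L : ℂ) * (Nat.card L : ℂ) := by
    have a1 : ∑ l : L, ∑ y : K, Qq I (4 * s) (y + l) * psiq (4 * s) (c * (y + l))
        = (Nat.card L : ℂ) * ∑ y : K, Qq I (4 * s) y * psiq (4 * s) (c * y) := by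
      have : ∀ l : L, ∑ y : K, Qq I (4 * s) (y + l) * psiq (4 * s) (c * (y + l))
          = ∑ y : K, Qq I (4 * s) y * psiq (4 * s) (c * y) := fun l =>
        Equiv.sum_comp (Equiv.addRight (l : K))
          (fun y : K => Qq I (4 * s) y * psiq (4 * s) (c * y))
      rw [Finset.sum_congr rfl fun l _ => this l, Finset.sum_const, nsmul_eq_mul,
        Finset.card_univ, Nat.card_eq_fintype_card]
    have a2 : ∀ y : K, ∑ l : L, Qq I (4 * s) (y + l) * psiq (4 * s) (c * (y + l))
        = if y ∈ L then (Nat.card L : ℂ) else 0 := by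
      intro y
      have b1 : ∀ l : L, Qq I (4 * s) (y + l) * psiq (4 * s) (c * (y + l))
          = (Qq I (4 * s) y * psiq (4 * s) (c * y)) * psiq (4 * s) (l * y) := by
        intro l
        rw [Q_add' hcard hI, mul_add, psi_add hcard, mul_comm y]
        linear_combination (Qq I (4 * s) y * psiq (4 * s) (c * y) * psiq (4 * s) (l * y)) *
          hQL l.1 l.2
      rw [Finset.sum_congr rfl fun l _ => b1 l, ← Finset.mul_sum, sum_psi hcard, ← hLL]
      split_ifs with h
      · rw [hQL y h, one_mul]
      · rw [mul_zero]
    rw [← a1, Finset.sum_comm, Finset.sum_congr rfl fun y _ => a2 y, ← Finset.sum_filter,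
      Finset.sum_const, nsmul_eq_mul]
    congr 2
    rw [Nat.card_eq_fintype_card, Fintype.card_subtype]
  have hLne : (Nat.card L : ℂ) ≠ 0 := by exact_mod_cast Nat.card_pos.ne'
  have hsum' := mul_left_cancel₀ hLne hsum
  have hshift : ∑ y : K, Qq I (4 * s) y
      = Qq I (4 * s) c * ∑ y : K, Qq I (4 * s) y * psiq (4 * s) (c * y) := by
    rw [← Equiv.sum_comp (Equiv.addRight c) (fun y : K => Qq I (4 * s) y), Finset.mul_sum]
    refine Finset.sum_congr rfl fun y _ => ?_
    rw [Equiv.coe_addRight, Q_add' hcard hI, mul_comm y]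
    ring
  rw [hshift, hsum', hQc, hLc]
  push_cast
  rfl

end fin

section roots

variable {L : Type*} [Field L] [CharP L 2] [PerfectRing L 2]

theorem rt_pow (j : ℕ) (x : L) : rt L j x ^ 2 ^ j = x := by
  unfold rt
  induction j generalizing x with
  | zero => simp
  | succ j ih =>
    rw [Function.iterate_succ_apply', pow_succ', pow_mul]
    have := frobeniusEquiv_symm_pow_p L 2 ((fun y => (frobeniusEquiv L 2).symm y)^[j] x)
    rw [this, ih]

theorem pow2_inj (j : ℕ) {x y : L} (h : x ^ 2 ^ j = y ^ 2 ^ j) : x = y := by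
  have : (x + y) ^ 2 ^ j = 0 := by rw [c2pow_add, h, CharTwo.add_self_eq_zero]
  exact CharTwo.add_eq_zero.mp (pow_eq_zero_iff (by positivity) |>.mp this)

theorem rt_add (j : ℕ) (x y : L) : rt L j (x + y) = rt L j x + rt L j y := by
  apply pow2_inj j
  rw [c2pow_add, rt_pow, rt_pow, rt_pow]

theorem rt_zero (j : ℕ) : rt L j (0 : L) = 0 := by
  apply pow2_inj j
  rw [rt_pow, zero_pow (by positivity)]

/-- The adjoint as an additive map. -/
def adjHom (k e : ℕ) (c : ℕ → L) : L →+ L where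
  toFun := adj k e c
  map_zero' := by simp [adj, rt_zero]
  map_add' x y := by simp only [adj, mul_add, rt_add, Finset.sum_add_distrib]

/-- `F` as an additive map. -/
def LpolyHom (k e : ℕ) (c : ℕ → L) : L →+ L where
  toFun := Lpoly (2 ^ k) e c
  map_zero' := by
    unfold Lpoly
    refine Finset.sum_eq_zero fun i _ => ?_
    rw [zero_pow (by positivity), mul_zero]
  map_add' x y := by
    simp only [Lpoly, ← pow_mul, c2pow_add, mul_add, Finset.sum_add_distrib]

theorem rt_map {M : Type*} [Field M] [CharP M 2] [PerfectRing M 2] (f : L →+* M) (j : ℕ) (x : L) :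
    f (rt L j x) = rt M j (f x) := by
  apply pow2_inj j
  rw [← map_pow, rt_pow, rt_pow]

theorem adj_map {M : Type*} [Field M] [CharP M 2] [PerfectRing M 2] (f : L →+* M) (k e : ℕ)
    (c : ℕ → L) (x : L) : f (adj k e c x) = adj k e (fun i => f (c i)) (f x) := by
  simp only [adj, map_sum, rt_map, map_mul]

open Polynomial in
/-- The polynomial whose roots are the zeros of the adjoint. -/
def adjPoly (k e : ℕ) (c : ℕ → L) : L[X] :=
  ∑ i ∈ Finset.range (e + 1), C (c i ^ 2 ^ (k * (e - i))) * X ^ 2 ^ (k * (e - i))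

open Polynomial in
theorem adjPoly_eval (k e : ℕ) (c : ℕ → L) (x : L) :
    (adjPoly k e c).eval x = adj k e c x ^ 2 ^ (k * e) := by
  have hs : ∀ (s : Finset ℕ) (f : ℕ → L) (j : ℕ), (∑ i ∈ s, f i) ^ 2 ^ j = ∑ i ∈ s, f i ^ 2 ^ j := by
    intro s f j
    exact sum_pow_char_pow 2 j s f
  rw [adj, hs, adjPoly, eval_finsetSum]
  refine Finset.sum_congr rfl fun i hi => ?_
  have hi' : i ≤ e := by rw [Finset.mem_range] at hi; omega
  have : k * e = k * i + k * (e - i) := by rw [← mul_add, Nat.add_sub_cancel' hi']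
  rw [this, pow_add 2, pow_mul (rt L (k * i) (c i * x)), rt_pow]
  simp [mul_pow]

open Polynomial in
theorem adjPoly_sep (k e : ℕ) (hk : 1 ≤ k) (c : ℕ → L) (hc : c e ≠ 0) :
    (adjPoly k e c).Separable := by
  have hd : derivative (adjPoly k e c) = C (c e) := by
    rw [adjPoly, derivative_sum, Finset.sum_range_succ, Finset.sum_eq_zero]
    · simp
    · intro i hi
      rw [Finset.mem_range] at hi
      rw [derivative_C_mul_X_pow]
      have : k * (e - i) ≠ 0 := by
        apply Nat.mul_ne_zero <;> omega
      have h2 : ((2 ^ (k * (e - i)) : ℕ) : L) = 0 := by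
        rw [Nat.cast_pow]
        have : ((2 : ℕ) : L) = 0 := CharP.cast_eq_zero L 2
        rw [this, zero_pow (by assumption)]
      rw [h2]; simp
  rw [Separable, hd]
  refine ⟨0, C (c e)⁻¹, ?_⟩
  rw [zero_mul, zero_add, ← C_mul, inv_mul_cancel₀ hc, C_1]

open Polynomial in
theorem adjPoly_deg (k e : ℕ) (hk : 1 ≤ k) (c : ℕ → L) (hc : c 0 ≠ 0) :
    (adjPoly k e c).natDegree = 2 ^ (k * e) := by
  rw [adjPoly, Finset.sum_range_succ']
  have h0 : (C (c 0 ^ 2 ^ (k * (e - 0))) * X ^ 2 ^ (k * (e - 0)) : L[X]).natDegree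
      = 2 ^ (k * e) := by
    rw [natDegree_C_mul_X_pow _ _ (pow_ne_zero _ hc), Nat.sub_zero]
  rw [natDegree_add_eq_right_of_natDegree_lt, h0]
  rw [h0]
  apply lt_of_le_of_lt (b := 2 ^ (k * e) - 1)
  · apply natDegree_sum_le_of_forall_le
    intro i hi
    rw [Finset.mem_range] at hi
    refine (natDegree_C_mul_X_pow_le _ _).trans ?_
    apply Nat.le_sub_one_of_lt
    apply Nat.pow_lt_pow_right (by norm_num)
    apply Nat.mul_lt_mul_of_pos_left <;> omega
  · have : 0 < 2 ^ (k * e) := by positivity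
    omega

end roots

section fin2

variable [Fintype K] {n : ℕ}

open Polynomial in
theorem card_W (k e : ℕ) (hk : 1 ≤ k) (b : ℕ → K) (hb1 : b 0 * b e ≠ 0)
    (hb3 : ∀ x : AlgebraicClosure K, adjBar k e b x = 0 →
      x ∈ Set.range (algebraMap K (AlgebraicClosure K))) :
    Nat.card (adjHom k e b).ker = 2 ^ (k * e) := by
  set f := algebraMap K (AlgebraicClosure K) with hf
  set P := adjPoly k e (fun i => f (b i)) with hP
  have h0 : f (b 0) ≠ 0 := by
    rw [_root_.map_ne_zero]; exact left_ne_zero_of_mul hb1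
  have he : f (b e) ≠ 0 := by
    rw [_root_.map_ne_zero]; exact right_ne_zero_of_mul hb1
  have hdeg : P.natDegree = 2 ^ (k * e) := adjPoly_deg k e hk _ h0
  have hsep : P.Separable := adjPoly_sep k e hk _ he
  have hne : P ≠ 0 := by
    intro h; rw [h, natDegree_zero] at hdeg
    have : 0 < 2 ^ (k * e) := by positivity
    omega
  have hr : ∀ x, P.IsRoot x ↔ adjBar k e b x = 0 := by
    intro x
    rw [IsRoot, hP, adjPoly_eval, pow_eq_zero_iff (by positivity)]
    rfl
  rw [← hdeg, ← IsAlgClosed.card_roots_eq_natDegree,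
    ← Multiset.toFinset_card_of_nodup (nodup_roots hsep)]
  have himg : P.roots.toFinset = (Finset.univ.filter fun v => v ∈ (adjHom k e b).ker).image f := by
    ext x
    rw [Multiset.mem_toFinset, mem_roots hne, hr, Finset.mem_image]
    constructor
    · intro h
      obtain ⟨v, rfl⟩ := hb3 x h
      refine ⟨v, ?_, rfl⟩
      rw [Finset.mem_filter]
      refine ⟨Finset.mem_univ _, ?_⟩
      have h' : f (adj k e b v) = 0 := by rw [adj_map]; exact h
      rw [map_eq_zero] at h'
      exact h'
    · rintro ⟨v, hv, rfl⟩
      rw [Finset.mem_filter] at hv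
      have h' : adj k e b v = 0 := hv.2
      show adj k e (fun i => f (b i)) (f v) = 0
      rw [← adj_map, h', map_zero]
  rw [himg, Finset.card_image_of_injective _ f.injective, Nat.card_eq_fintype_card,
    Fintype.card_subtype]

theorem tr2_rt (hcard : Fintype.card K = 2 ^ n) (j : ℕ) (z x : K) :
    tr2 n (rt K j z * x) = tr2 n (z * x ^ 2 ^ j) := by
  rw [← tr2_pow hcard (rt K j z * x) j, mul_pow, rt_pow]

theorem adjunction (hcard : Fintype.card K = 2 ^ n) (k e : ℕ) (b : ℕ → K) (t x : K) :
    psiq n (t * LpolyHom k e b x) = psiq n (adjHom k e b t * x) := by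
  apply psi_congr
  show tr2 n (t * Lpoly (2 ^ k) e b x) = tr2 n (adj k e b t * x)
  rw [Lpoly, adj, Finset.mul_sum, Finset.sum_mul, tr2_sum, tr2_sum]
  refine Finset.sum_congr rfl fun i _ => ?_
  rw [tr2_rt hcard, ← pow_mul]
  congr 1
  ring

theorem tr2_RF (hcard : Fintype.card K = 2 ^ n) (k e : ℕ) (b : ℕ → K) (x : K) :
    tr2 n (x * RF k e b x) = tr2 n (∑ i ∈ Finset.range (e + 1), ∑ j ∈ Finset.Ioo i (e + 1),
      (b i * x ^ (2 ^ k) ^ i) * (b j * x ^ (2 ^ k) ^ j)) := by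
  have h1 : tr2 n (x * RF k e b x) = ∑ i ∈ Finset.Icc 1 e, ∑ j ∈ Finset.range (e - i + 1),
      tr2 n ((b j * x ^ (2 ^ k) ^ j) * (b (j + i) * x ^ (2 ^ k) ^ (j + i))) := by
    rw [RF, Finset.mul_sum, tr2_sum]
    refine Finset.sum_congr rfl fun i _ => ?_
    rw [aRF, Finset.sum_mul, Finset.mul_sum, tr2_sum]
    refine Finset.sum_congr rfl fun j _ => ?_
    rw [show x * (rt K (k * j) (b j * b (j + i)) * x ^ (2 ^ k) ^ i)
      = rt K (k * j) (b j * b (j + i)) * (x * x ^ (2 ^ k) ^ i) by ring, tr2_rt hcard]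
    congr 1
    rw [mul_pow, pow_add (2 ^ k) j i, pow_mul 2 k j, ← pow_mul x ((2 ^ k) ^ i),
      mul_comm ((2 ^ k) ^ i)]
    ring
  rw [h1, tr2_sum]
  simp only [tr2_sum]
  rw [Finset.sum_sigma', Finset.sum_sigma']
  refine Finset.sum_bij' (fun a _ => ⟨a.2, a.2 + a.1⟩) (fun a _ => ⟨a.2 - a.1, a.1⟩) ?_ ?_ ?_ ?_ ?_
  · rintro ⟨i, j⟩ h
    simp only [Finset.mem_sigma, Finset.mem_Icc, Finset.mem_range, Finset.mem_Ioo] at h ⊢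
    omega
  · rintro ⟨i, j⟩ h
    simp only [Finset.mem_sigma, Finset.mem_Icc, Finset.mem_range, Finset.mem_Ioo] at h ⊢
    omega
  · rintro ⟨i, j⟩ h
    simp
  · rintro ⟨i, j⟩ h
    simp only [Finset.mem_sigma, Finset.mem_Icc, Finset.mem_range, Finset.mem_Ioo] at h ⊢
    simp only [Sigma.mk.injEq, heq_eq_eq, true_and]
    omega
  · rintro ⟨i, j⟩ h
    rfl

theorem Q_F (hcard : Fintype.card K = 2 ^ n) {I : ℂ} (hI : I ^ 2 = -1) (k e : ℕ) (b : ℕ → K)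
    (hb2 : adj k e b 1 = 0) (x : K) :
    Qq I n (LpolyHom k e b x) = psiq n (x * RFt k e b 0 x) := by
  have hp : ∀ i, ((2 : ℕ) ^ k) ^ i = 2 ^ (k * i) := fun i => (pow_mul 2 k i).symm
  have h1 := Q_sum hcard hI (fun i => b i * x ^ (2 ^ k) ^ i) (e + 1)
  have h2 := Q_sum hcard hI (fun i => rt K (k * i) (b i) * x) (e + 1)
  have h3 : ∏ i ∈ Finset.range (e + 1), Qq I n (b i * x ^ (2 ^ k) ^ i)
      = ∏ i ∈ Finset.range (e + 1), Qq I n (rt K (k * i) (b i) * x) := by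
    refine Finset.prod_congr rfl fun i _ => ?_
    rw [← Q_pow hcard I (rt K (k * i) (b i) * x) (k * i), mul_pow, rt_pow, hp]
  have h4 : ∑ i ∈ Finset.range (e + 1), rt K (k * i) (b i) * x = 0 := by
    rw [← Finset.sum_mul]
    simp only [adj, mul_one] at hb2
    rw [hb2, zero_mul]
  have h5 : ∑ i ∈ Finset.range (e + 1), ∑ j ∈ Finset.Ioo i (e + 1),
      (rt K (k * i) (b i) * x) * (rt K (k * j) (b j) * x) = gammaF k e b * x * x := by
    rw [gammaF, mul_assoc, Finset.sum_mul]
    refine Finset.sum_congr rfl fun i _ => ?_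
    rw [Finset.sum_mul]
    refine Finset.sum_congr rfl fun j _ => ?_
    ring
  rw [h3, ← h2, h4, h5, Q_zero, one_mul, ← psi_congr (tr2_RF hcard k e b x)] at h1
  have h6 : alphaF k e b 0 = gammaF k e b := by
    have : adj k e b 0 = 0 := (adjHom k e b).map_zero
    rw [alphaF, this]; simp
  rw [RFt, h6, mul_add, psi_add hcard, show x * (gammaF k e b * x) = gammaF k e b * x * x by ring,
    ← h1]
  have h7 := psi_mul_self (n := n) (x * RF k e b x)
  show Qq I n (Lpoly (2 ^ k) e b x) = _ * (Qq I n (Lpoly (2 ^ k) e b x) * _)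
  linear_combination (-Qq I n (Lpoly (2 ^ k) e b x)) * h7

theorem RF_hom (k e : ℕ) (b : ℕ → K) (a d x : K) (hd : d ^ 2 ^ k = d) :
    RF k e b (d * x) + a * (d * x) = d * (RF k e b x + a * x) := by
  have h : ∀ i, d ^ (2 ^ k) ^ i = d := by
    intro i
    induction i with
    | zero => simp
    | succ i ih => rw [pow_succ, pow_mul, ih, hd]
  rw [RF, RF, mul_add, Finset.mul_sum]
  congr 1
  · refine Finset.sum_congr rfl fun i _ => ?_
    rw [mul_pow, h]; ring
  · ring

end fin2

section final

variable [Fintype K]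

theorem G_eq {n : ℕ} (hcard : Fintype.card K = 2 ^ n) {I : ℂ} (hI : I ^ 2 = -1) (k e : ℕ)
    (b : ℕ → K) (hb2 : adj k e b 1 = 0) (σ : K) :
    ∑ x : K, psiq n (x * (RF k e b x + (gammaF k e b + σ ^ 2) * x))
      = ∑ x : K, Qq I n (LpolyHom k e b x) * psiq n (σ * x) := by
  refine Finset.sum_congr rfl fun x _ => ?_
  rw [Q_F hcard hI k e b hb2, ← psi_pow hcard (σ * x) 1, ← psi_add hcard]
  congr 1
  have h6 : alphaF k e b 0 = gammaF k e b := by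
    have : adj k e b 0 = 0 := (adjHom k e b).map_zero
    rw [alphaF, this]; simp
  rw [RFt, h6]
  ring

theorem natCast_01 (j : ℕ) : (j : K) = 0 ∨ (j : K) = 1 := by
  have h2 : (1 : K) + 1 = 0 := CharTwo.add_self_eq_zero 1
  induction j with
  | zero => simp
  | succ j ih =>
    push_cast
    rcases ih with h | h <;> rw [h] <;> simp [h2]

variable (k s e : ℕ) (hk : 1 ≤ k) (hks : k ∣ s) (hs : s ≠ 0)
    (hcard : Fintype.card K = 2 ^ (4 * s))
    (b : ℕ → K)
    (hb1 : b 0 * b e ≠ 0)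
    (hb2 : adj k e b 1 = 0)
    (hb3 : ∀ x : AlgebraicClosure K, adjBar k e b x = 0 →
      x ∈ Set.range (algebraMap K (AlgebraicClosure K)))
    (hsub : ∀ v : K, adj k e b v = 0 → v ^ 2 ^ s = v)
    (I : ℂ) (hI : I ^ 2 = -1)

include hk hks hs hcard hb2 hsub I hI in
theorem N_zero (a : K)
    (ha : a ∉ Set.range (fun u : K => gammaF k e b + adj k e b (Lpoly (2 ^ k) e b u) ^ 2)) :
    (Ncount K (2 ^ k) (fun x => RF k e b x + a * x) : ℤ) = 2 ^ (4 * s) := by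
  have hN := Ncount_eq hcard hk (hks.trans ⟨4, by ring⟩) (by omega)
    (fun x => RF k e b x + a * x) (fun d x hd => RF_hom k e b a d x hd)
  have hσ : ∃ σ : K, a = gammaF k e b + σ ^ 2 := by
    refine ⟨rt K 1 (a - gammaF k e b), ?_⟩
    have := rt_pow 1 (a - gammaF k e b)
    rw [pow_one] at this
    rw [this]; ring
  obtain ⟨σ, rfl⟩ := hσ
  rw [G_eq hcard hI k e b hb2, sum_zero hcard hI (LpolyHom k e b) (adjHom k e b)
    (adjunction hcard k e b) (fun w hw => Q_sub I s w (hsub w hw))] at hN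
  · rw [mul_zero, add_zero] at hN
    exact_mod_cast hN
  · intro u hu
    exact ha ⟨u, by rw [← hu]; rfl⟩

include hk hks hs hcard hb1 hb2 hb3 hsub I hI in
theorem N_range (u : K) :
    (Ncount K (2 ^ k) (fun x => RF k e b x +
        (gammaF k e b + adj k e b (Lpoly (2 ^ k) e b u) ^ 2) * x) : ℤ)
      = 2 ^ (4 * s) + (if tr2 (4 * s) (u * RFt k e b 0 u) = ((s + 1 : ℕ) : K) then 1 else -1) *
        ((2 ^ k - 1) * (2 ^ k) ^ e * 2 ^ (2 * s)) := by
  have hN := Ncount_eq hcard hk (hks.trans ⟨4, by ring⟩) (by omega)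
    (fun x => RF k e b x + (gammaF k e b + adj k e b (Lpoly (2 ^ k) e b u) ^ 2) * x)
    (fun d x hd => RF_hom k e b _ d x hd)
  have hQ : ∀ w, adjHom k e b w = 0 → Qq I (4 * s) w = 1 := fun w hw => Q_sub I s w (hsub w hw)
  have hW : ∀ w w', adjHom k e b w = 0 → adjHom k e b w' = 0 → psiq (4 * s) (w * w') = 1 := by
    intro w w' hw hw'
    have h4 : 4 * s = 2 * s + 2 * s := by ring
    have hfix : (w * w') ^ 2 ^ s = w * w' := by rw [mul_pow, hsub w hw, hsub w' hw']
    have : tr2 (4 * s) (w * w') = 0 := by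
      rw [h4]; apply tr2_two
      rw [two_mul, pow_add, pow_mul, hfix, hfix]
    simp [psiq, this]
  have hsh := sum_shift hcard hI (LpolyHom k e b) (adjHom k e b) (adjunction hcard k e b) u
  rw [sum_G0 hcard hI (LpolyHom k e b) (adjHom k e b) (adjunction hcard k e b) hQ hW,
    gauss s hs hcard hI, card_W k e hk b hb1 hb3, Q_F hcard hI k e b hb2] at hsh
  have hG := G_eq hcard hI k e b hb2 (adj k e b (Lpoly (2 ^ k) e b u))
  rw [hG] at hN
  set S := ∑ x : K, Qq I (4 * s) (LpolyHom k e b x) *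
    psiq (4 * s) (adj k e b (Lpoly (2 ^ k) e b u) * x) with hS
  have hsh' : psiq (4 * s) (u * RFt k e b 0 u) * S = ((2 ^ (k * e) : ℕ) : ℂ) *
    ((if ((s + 1 : ℕ) : K) = 0 then 1 else -1) * 2 ^ (2 * s)) := hsh
  have hps := psi_mul_self (n := 4 * s) (u * RFt k e b 0 u)
  have hS2 : S = psiq (4 * s) (u * RFt k e b 0 u) * (((2 ^ (k * e) : ℕ) : ℂ) *
    ((if ((s + 1 : ℕ) : K) = 0 then 1 else -1) * 2 ^ (2 * s))) := by
    rw [← hsh', ← mul_assoc, hps, one_mul]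
  have hsign : psiq (4 * s) (u * RFt k e b 0 u) * (if ((s + 1 : ℕ) : K) = 0 then 1 else -1)
      = (((if tr2 (4 * s) (u * RFt k e b 0 u) = ((s + 1 : ℕ) : K) then 1 else -1 : ℤ)) : ℂ) := by
    unfold psiq
    rcases tr2_01 hcard (u * RFt k e b 0 u) with h | h <;>
      rcases natCast_01 (K := K) (s + 1) with h' | h' <;> rw [h, h'] <;> simp
  have hfin : (Ncount K (2 ^ k) (fun x => RF k e b x +
        (gammaF k e b + adj k e b (Lpoly (2 ^ k) e b u) ^ 2) * x) : ℂ)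
      = 2 ^ (4 * s) +
        (((if tr2 (4 * s) (u * RFt k e b 0 u) = ((s + 1 : ℕ) : K) then 1 else -1 : ℤ)) : ℂ) *
        ((2 ^ k - 1) * (2 ^ k) ^ e * 2 ^ (2 * s)) := by
    rw [hN, hS2, ← hsign, pow_mul 2 k e]
    push_cast
    ring
  generalize (if tr2 (4 * s) (u * RFt k e b 0 u) = ((s + 1 : ℕ) : K) then (1 : ℤ) else -1) = δ
    at hfin ⊢
  exact_mod_cast hfin

include hcard hsub in
theorem SF_eq (m : ℕ) (hkm : k * m = 4 * s) :
    SF K I k m e b = Set.range (Lpoly (2 ^ k) e b) := by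
  have hr := perp_range hcard (LpolyHom k e b) (adjHom k e b) (adjunction hcard k e b)
  ext t
  have h1 : t ∈ Set.range (Lpoly (2 ^ k) e b) ↔ t ∈ (LpolyHom k e b).range := Iff.rfl
  rw [h1, hr, mem_perp, SF, Set.mem_ofPred_eq, hkm]
  have h2 : ∀ v : K, adjBar k e b (algebraMap K (AlgebraicClosure K) v) = 0 ↔
      v ∈ (adjHom k e b).ker := by
    intro v
    rw [AddMonoidHom.mem_ker]
    show adj k e (fun i => algebraMap K (AlgebraicClosure K) (b i)) _ = 0 ↔ adj k e b v = 0
    rw [← adj_map, map_eq_zero]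
  constructor
  · intro h v hv
    have := h v ((h2 v).mpr hv)
    rw [Q_sub I s v (hsub v hv)] at this
    rw [mul_comm v t]; exact this.symm
  · intro h v hv
    rw [h2] at hv
    rw [Q_sub I s v (hsub v hv), mul_comm t v, h v hv]

end final

end helpers

/-- Explicit description of `S_F` and `T_{R,max}` when `4 ∣ [𝔽_q:𝔽_p]`
and `W_F^* ⊆ 𝔽_{q^{1/4}}`. -/
theorem statement10 {K : Type*} [Field K] [Fintype K] [CharP K 2]
    (k m e : ℕ) (hk : 1 ≤ k) (hm : 1 ≤ m) (he : 1 ≤ e) (h4 : 4 ∣ m)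
    (hcard : Fintype.card K = 2 ^ (k * m))
    (b : ℕ → K)
    (hb1 : b 0 * b e ≠ 0)
    (hb2 : adjBar k e b 1 = 0)
    (hb3 : ∀ x : AlgebraicClosure K, adjBar k e b x = 0 →
      x ∈ Set.range (algebraMap K (AlgebraicClosure K)))
    (hb4 : ∀ x : AlgebraicClosure K, adjBar k e b (LpolyBar k e b x) = 0 →
      x ∈ Set.range (algebraMap K (AlgebraicClosure K)))
    (hsub : ∀ v : K, adjBar k e b (algebraMap K (AlgebraicClosure K) v) = 0 →
      v ^ 2 ^ (k * (m / 4)) = v)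
    (I : ℂ) (hI : I ^ 2 = -1) :
    SF K I k m e b = Set.range (Lpoly (2 ^ k) e b) ∧
    TRmax K k m e b ∪ TRmin K k m e b
      = Set.range (fun u : K => gammaF k e b + adj k e b (Lpoly (2 ^ k) e b u) ^ 2) ∧
    TRmax K k m e b
      = (fun u : K => gammaF k e b + adj k e b (Lpoly (2 ^ k) e b u) ^ 2) ''
          {u : K | tr2 (k * m) (u * RFt k e b 0 u) = ((k * m / 4 + 1 : ℕ) : K)} := by
  have hbar : ∀ v : K, adjBar k e b (algebraMap K (AlgebraicClosure K) v) = 0 ↔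
      adj k e b v = 0 := by
    intro v
    show adj k e (fun i => algebraMap K (AlgebraicClosure K) (b i)) _ = 0 ↔ adj k e b v = 0
    rw [← adj_map, map_eq_zero]
  obtain ⟨m0, rfl⟩ := h4
  have hn : k * (4 * m0) = 4 * (k * m0) := by ring
  have hd4 : 4 * m0 / 4 = m0 := by omega
  rw [hd4] at hsub
  rw [hn] at hcard
  have hs : k * m0 ≠ 0 := Nat.mul_ne_zero (by omega) (by omega)
  have hb2' : adj k e b 1 = 0 := by
    rw [← hbar, map_one]; exact hb2
  have hsub' : ∀ v : K, adj k e b v = 0 → v ^ 2 ^ (k * m0) = v :=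
    fun v hv => hsub v ((hbar v).mpr hv)
  have hkd : k ∣ k * m0 := dvd_mul_right _ _
  have hA := N_range k (k * m0) e hk hkd hs hcard b hb1 hb2' hb3 hsub' I hI
  have hB := N_zero k (k * m0) e hk hkd hs hcard b hb2' hsub' I hI
  have hhalf : 4 * (k * m0) / 2 = 2 * (k * m0) := by omega
  have hquart : 4 * (k * m0) / 4 = k * m0 := by omega
  have hM : (0 : ℤ) < (2 ^ k - 1) * (2 ^ k) ^ e * 2 ^ (2 * (k * m0)) := by
    have : (1 : ℤ) < 2 ^ k := one_lt_pow₀ (by norm_num) (by omega)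
    have h1 : (0 : ℤ) < 2 ^ k - 1 := by linarith
    positivity
  refine ⟨SF_eq k (k * m0) e hcard b hsub' I (4 * m0) hn, ?_, ?_⟩
  · ext a
    simp only [TRmax, TRmin, Set.mem_union, Set.mem_ofPred_eq, hn, hhalf]
    constructor
    · intro h
      by_contra hne
      rw [hB a hne] at h
      rcases h with h | h <;> linarith
    · rintro ⟨u, rfl⟩
      simp only []
      rw [hA u]
      split_ifs
      · left; ring
      · right; ring
  · ext a
    simp only [TRmax, Set.mem_ofPred_eq, hn, hhalf, hquart, Set.mem_image]
    constructor
    · intro h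
      by_cases hne : a ∈ Set.range
          (fun u : K => gammaF k e b + adj k e b (Lpoly (2 ^ k) e b u) ^ 2)
      · obtain ⟨u, rfl⟩ := hne
        refine ⟨u, ?_, rfl⟩
        simp only [] at h
        rw [hA u] at h
        by_contra hu
        rw [if_neg hu] at h
        linarith
      · rw [hB a hne] at h
        linarith
    · rintro ⟨u, hu, rfl⟩
      rw [hA u, if_pos hu]
      ring

end
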